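/- arXiv:0812.3593 — 2 statements merged into one kernel-verified Lean document; each statement's English description precedes it below -/
import Mathlib

section
/- The number of spanning hypertrees of the complete k-uniform hypergraph on N = (k-1)n + 1 vertices equals ((k-1)n)! / ( ((k-1)n + 1) · n! ) · ( ((k-1)n + 1) / (k-1)! )^n. -/
variable {α : Type*} [DecidableEq α]

/-- Two vertices are adjacent in a hypergraph with hyperedge set `E`
if they are distinct and lie in a common hyperedge. -/
def HypAdj (E : Finset (Finset α)) (u v : α) : Prop :=
  u ≠ v ∧ ∃ e ∈ E, u ∈ e ∧ v ∈ e

/-- A hypergraph with vertex set `V` and hyperedge set `E` is connected if any two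
vertices are joined by a path of adjacent vertices. -/
def HypConnected (V : Finset α) (E : Finset (Finset α)) : Prop :=
  ∀ u ∈ V, ∀ v ∈ V, Relation.ReflTransGen (HypAdj E) u v

/-- A hypergraph has a cycle if there is a cyclic alternating sequence
`v₁, A₁, v₂, A₂, …, v_ℓ, A_ℓ, v_{ℓ+1} = v₁` with `ℓ ≥ 2`, the hyperedges `Aᵢ ∈ E`
pairwise distinct, `vᵢ ≠ vᵢ₊₁`, and `vᵢ, vᵢ₊₁ ∈ Aᵢ` for all `i`. -/
def HypHasCycle (E : Finset (Finset α)) : Prop :=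
  ∃ (ℓ : ℕ) (v : Fin (ℓ + 1) → α) (A : Fin ℓ → Finset α),
    2 ≤ ℓ ∧ v (Fin.last ℓ) = v 0 ∧ Function.Injective A ∧
    ∀ i : Fin ℓ, A i ∈ E ∧ v i.castSucc ≠ v i.succ ∧ v i.castSucc ∈ A i ∧ v i.succ ∈ A i

/-- `(V, E)` is a hypertree: the hyperedges lie inside `V`, and the hypergraph
is connected and has no cycle. -/
def IsHypertree (V : Finset α) (E : Finset (Finset α)) : Prop :=
  (∀ e ∈ E, e ⊆ V) ∧ HypConnected V E ∧ ¬ HypHasCycle E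

/-- `E'` is (the hyperedge set of) a spanning hypertree of the hypergraph `(V, E)`. -/
def IsSpanningHypertree (V : Finset α) (E E' : Finset (Finset α)) : Prop :=
  E' ⊆ E ∧ IsHypertree V E'

/-! ### Connectivity -/

/-- Reachability in the hypergraph with hyperedge set `E`. -/
def Conn (E : Finset (Finset α)) (u v : α) : Prop := Relation.ReflTransGen (HypAdj E) u v

theorem Conn.rfl {E : Finset (Finset α)} {u : α} : Conn E u u := Relation.ReflTransGen.refl

theorem Conn.trans {E : Finset (Finset α)} {u v w : α} (h : Conn E u v) (h' : Conn E v w) :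
    Conn E u w := Relation.ReflTransGen.trans h h'

theorem Conn.symm {E : Finset (Finset α)} {u v : α} (h : Conn E u v) : Conn E v u := by
  induction h with
  | refl => exact Conn.rfl
  | tail _ h ih =>
    obtain ⟨hne, e, he, hx, hy⟩ := h
    exact Conn.trans (Relation.ReflTransGen.single ⟨hne.symm, e, he, hy, hx⟩) ih

theorem Conn.mono {E F : Finset (Finset α)} (hEF : E ⊆ F) {u v : α} (h : Conn E u v) :
    Conn F u v := by
  induction h with
  | refl => exact Conn.rfl
  | tail _ h ih =>
    obtain ⟨hne, e, he, hx, hy⟩ := h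
    exact Conn.trans ih (Relation.ReflTransGen.single ⟨hne, e, hEF he, hx, hy⟩)

theorem Conn.of_mem {E : Finset (Finset α)} {e : Finset α} (he : e ∈ E) {u v : α}
    (hu : u ∈ e) (hv : v ∈ e) : Conn E u v := by
  by_cases h : u = v
  · subst h; exact Conn.rfl
  · exact Relation.ReflTransGen.single ⟨h, e, he, hu, hv⟩

theorem conn_empty {u v : α} (h : Conn (∅ : Finset (Finset α)) u v) : u = v := by
  induction h with
  | refl => rfl
  | tail _ h _ => obtain ⟨_, e, he, _⟩ := h; simp at he

theorem Conn.of_insert {E : Finset (Finset α)} {e : Finset α} {x y : α}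
    (h : Conn (insert e E) x y) :
    Conn E x y ∨ ∃ a ∈ e, ∃ b ∈ e, Conn E x a ∧ Conn E b y := by
  induction h with
  | refl => exact Or.inl Conn.rfl
  | @tail y z _ h ih =>
    obtain ⟨hne, f, hf, hy, hz⟩ := h
    rcases Finset.mem_insert.1 hf with rfl | hf
    · rcases ih with ih | ⟨a, ha, b, hb, hxa, hby⟩
      · exact Or.inr ⟨y, hy, z, hz, ih, Conn.rfl⟩
      · exact Or.inr ⟨a, ha, z, hz, hxa, Conn.rfl⟩
    · have hyz : Conn E y z := Conn.of_mem hf hy hz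
      rcases ih with ih | ⟨a, ha, b, hb, hxa, hby⟩
      · exact Or.inl (ih.trans hyz)
      · exact Or.inr ⟨a, ha, b, hb, hxa, hby.trans hyz⟩

theorem Conn.through {E : Finset (Finset α)} {e : Finset α} {x y a b : α}
    (ha : a ∈ e) (hb : b ∈ e) (hxa : Conn E x a) (hby : Conn E b y) : Conn (insert e E) x y :=
  (hxa.mono (Finset.subset_insert _ _)).trans
    ((Conn.of_mem (Finset.mem_insert_self _ _) ha hb).trans
      (hby.mono (Finset.subset_insert _ _)))

/-! ### Acyclicity -/

/-- The vertices of `e` lie in distinct components of `E`. -/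
def HSep (E : Finset (Finset α)) (e : Finset α) : Prop :=
  ∀ u ∈ e, ∀ v ∈ e, Conn E u v → u = v

/-- Acyclicity via connectivity. -/
def Acy (E : Finset (Finset α)) : Prop := ∀ e ∈ E, HSep (E.erase e) e

theorem acy_insert {E : Finset (Finset α)} {e : Finset α} (he : e ∉ E) :
    Acy (insert e E) ↔ Acy E ∧ HSep E e := by
  constructor
  · intro h
    refine ⟨fun f hf u hu v hv huv => ?_, ?_⟩
    · exact h f (Finset.mem_insert_of_mem hf) u hu v hv
        (huv.mono (Finset.erase_subset_erase _ (Finset.subset_insert _ _)))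
    · have := h e (Finset.mem_insert_self _ _)
      rwa [Finset.erase_insert he] at this
  · rintro ⟨hA, hS⟩ f hf
    rcases Finset.mem_insert.1 hf with rfl | hf
    · rwa [Finset.erase_insert he]
    · have hne : e ≠ f := fun h => he (h ▸ hf)
      rw [Finset.erase_insert_of_ne hne]
      intro u hu v hv huv
      rcases huv.of_insert with h | ⟨a, ha, b, hb, hua, hbv⟩
      · exact hA f hf u hu v hv h
      · have hab : a = b := by
          refine hS a ha b hb ?_
          exact ((hua.symm.mono (Finset.erase_subset _ _)).trans (Conn.of_mem hf hu hv)).trans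
            (hbv.symm.mono (Finset.erase_subset _ _))
        subst hab
        exact hA f hf u hu v hv (hua.trans hbv)

/-- Trails: walks with pairwise distinct hyperedges. -/
inductive HTrail : α → α → List (Finset α) → Prop
  | nil (u : α) : HTrail u u []
  | cons {u w v : α} {A : Finset α} {l : List (Finset α)} (hne : u ≠ w) (hu : u ∈ A)
      (hw : w ∈ A) (hA : A ∉ l) (h : HTrail w v l) : HTrail u v (A :: l)

theorem HTrail.shortcut {u v : α} {l : List (Finset α)} (h : HTrail u v l) {A : Finset α}
    (hA : A ∈ l) {x : α} (hx : x ∈ A) : ∃ l', l' ⊆ l ∧ HTrail x v l' := by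
  induction h with
  | nil u => simp at hA
  | @cons u w v B l hne hu hw hB h ih =>
    rcases List.mem_cons.1 hA with rfl | hA
    · by_cases hxw : x = w
      · subst hxw; exact ⟨l, List.subset_cons_self _ _, h⟩
      · exact ⟨_, List.Subset.refl _, HTrail.cons hxw hx hw hB h⟩
    · obtain ⟨l', hl', ht⟩ := ih hA
      exact ⟨l', List.subset_cons_of_subset _ hl', ht⟩

theorem Conn.exists_trail {E : Finset (Finset α)} {u v : α} (h : Conn E u v) :
    ∃ l : List (Finset α), (∀ A ∈ l, A ∈ E) ∧ HTrail u v l := by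
  unfold Conn at h
  induction h using Relation.ReflTransGen.head_induction_on with
  | refl => exact ⟨[], by simp, HTrail.nil _⟩
  | @head x w h _ ih =>
    obtain ⟨hne, A, hA, hx, hw⟩ := h
    obtain ⟨l, hl, ht⟩ := ih
    by_cases hAl : A ∈ l
    · obtain ⟨l', hl', ht'⟩ := ht.shortcut hAl hx
      exact ⟨l', fun B hB => hl B (hl' hB), ht'⟩
    · refine ⟨A :: l, ?_, HTrail.cons hne hx hw hAl ht⟩
      intro B hB
      rcases List.mem_cons.1 hB with rfl | hB
      · exact hA
      · exact hl B hB

theorem HTrail.nodup {u v : α} {l : List (Finset α)} (h : HTrail u v l) : l.Nodup := by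
  induction h with
  | nil u => simp
  | cons hne hu hw hA h ih => exact List.nodup_cons.2 ⟨hA, ih⟩

theorem HTrail.exists_fun {u v : α} {l : List (Finset α)} (h : HTrail u v l) :
    ∃ p : Fin (l.length + 1) → α, p 0 = u ∧ p (Fin.last _) = v ∧
      ∀ i : Fin l.length, p i.castSucc ≠ p i.succ ∧ p i.castSucc ∈ l.get i ∧ p i.succ ∈ l.get i := by
  induction h with
  | nil u => exact ⟨fun _ => u, rfl, rfl, fun i => i.elim0⟩
  | @cons u w v B l hne hu hw hB h ih =>
    obtain ⟨p, h0, hl, hp⟩ := ih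
    refine ⟨Fin.cons u p, rfl, ?_, ?_⟩
    · exact hl
    · intro i
      refine Fin.cases ?_ (fun j => ?_) i
      · refine ⟨?_, hu, ?_⟩
        · show u ≠ p 0
          rwa [h0]
        · show p 0 ∈ B
          rwa [h0]
      · exact hp j

theorem acy_iff (E : Finset (Finset α)) : Acy E ↔ ¬ HypHasCycle E := by
  constructor
  · rintro hA ⟨ℓ, v, A, hℓ, hcl, hinj, h⟩
    obtain ⟨m, rfl⟩ : ∃ m, ℓ = m + 1 := ⟨ℓ - 1, by omega⟩
    have key : ∀ j : ℕ, ∀ hj : j < m + 1,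
        Conn (E.erase (A 0)) (v (Fin.succ 0)) (v (Fin.succ ⟨j, hj⟩)) := by
      intro j
      induction j with
      | zero => intro hj; exact Conn.rfl
      | succ j ih =>
        intro hj
        refine (ih (by omega)).trans ?_
        obtain ⟨h1, -, h2, h3⟩ := h ⟨j + 1, hj⟩
        refine Conn.of_mem (e := A ⟨j + 1, hj⟩) ?_ h2 h3
        refine Finset.mem_erase.2 ⟨fun hh => ?_, h1⟩
        have := hinj hh
        simp [Fin.ext_iff] at this
    have hc := key m (by omega)
    have hlast : v (Fin.succ ⟨m, by omega⟩) = v 0 := hcl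
    rw [hlast] at hc
    obtain ⟨h1, h2, h3, h4⟩ := h 0
    exact h2 (hA (A 0) h1 _ h4 _ h3 hc).symm
  · intro hC e he u hu v hv huv
    by_contra hne
    apply hC
    obtain ⟨l, hl, ht⟩ := huv.exists_trail
    have hel : e ∉ l := fun h => by simpa using hl e h
    have ht' : HTrail v v (e :: l) := HTrail.cons (Ne.symm hne) hv hu hel ht
    have hlne : l ≠ [] := by
      rintro rfl
      cases ht
      exact hne rfl
    obtain ⟨p, h0, hlast, hp⟩ := ht'.exists_fun
    refine ⟨(e :: l).length, p, (e :: l).get, ?_, by rw [h0, hlast],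
      List.nodup_iff_injective_get.1 ht'.nodup, fun i => ⟨?_, hp i⟩⟩
    · have := List.length_pos_iff.2 hlne
      simp only [List.length_cons]; omega
    · have : (e :: l).get i ∈ e :: l := List.get_mem _ _
      rcases List.mem_cons.1 this with h | h
      · rw [h]; exact he
      · exact Finset.mem_of_mem_erase (hl _ h)

/-! ### Transversals -/

/-- `R` contains exactly one vertex of every component. -/
def Trv (E : Finset (Finset α)) (R : Finset α) : Prop :=
  (∀ u, ∃ r ∈ R, Conn E u r) ∧ ∀ r ∈ R, ∀ s ∈ R, Conn E r s → r = s

theorem trv_backward {E : Finset (Finset α)} {e R' : Finset α} (hS : HSep E e)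
    (hne : e.Nonempty) (hT : Trv (insert e E) R') :
    ∃ v ∈ e, Trv E (R' ∪ e.erase v) ∧ Disjoint R' (e.erase v) := by
  have hv : ∃ v ∈ e, ∃ r ∈ R', Conn E v r := by
    obtain ⟨a, ha⟩ := hne
    obtain ⟨r, hr, har⟩ := hT.1 a
    rcases har.of_insert with h | ⟨_, _, b, hb, _, hbr⟩
    · exact ⟨a, ha, r, hr, h⟩
    · exact ⟨b, hb, r, hr, hbr⟩
  obtain ⟨v, hv, r, hr, hvr⟩ := hv
  have cross : ∀ r' ∈ R', ∀ s ∈ e.erase v, ¬ Conn E r' s := by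
    intro r' hr' s hs hc
    obtain ⟨hsv, hse⟩ := Finset.mem_erase.1 hs
    have : r' = r := hT.2 _ hr' _ hr (Conn.through hse hv hc hvr)
    subst this
    exact hsv (hS _ hse _ hv (hvr.trans hc).symm)
  refine ⟨v, hv, ⟨fun u => ?_, ?_⟩, ?_⟩
  · obtain ⟨r', hr', hur⟩ := hT.1 u
    rcases hur.of_insert with h | ⟨a, ha, b, hb, hua, hbr⟩
    · exact ⟨r', Finset.mem_union_left _ hr', h⟩
    · by_cases hav : a = v
      · subst hav
        exact ⟨r, Finset.mem_union_left _ hr, hua.trans hvr⟩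
      · exact ⟨a, Finset.mem_union_right _ (Finset.mem_erase.2 ⟨hav, ha⟩), hua⟩
  · intro x hx y hy hxy
    rcases Finset.mem_union.1 hx with hx | hx <;> rcases Finset.mem_union.1 hy with hy | hy
    · exact hT.2 _ hx _ hy (hxy.mono (Finset.subset_insert _ _))
    · exact absurd hxy (cross _ hx _ hy)
    · exact absurd hxy.symm (cross _ hy _ hx)
    · exact hS _ (Finset.mem_of_mem_erase hx) _ (Finset.mem_of_mem_erase hy) hxy
  · rw [Finset.disjoint_left]
    intro x hx hx'
    exact cross x hx x hx' Conn.rfl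

theorem trv_forward {E : Finset (Finset α)} {S R : Finset α} {v : α} (hT : Trv E R)
    (hSR : S ⊆ R) (hv : ∀ s ∈ S, ¬ Conn E v s) :
    HSep E (insert v S) ∧ Trv (insert (insert v S) E) (R \ S) := by
  refine ⟨?_, fun u => ?_, ?_⟩
  · intro x hx y hy hxy
    rcases Finset.mem_insert.1 hx with hx1 | hx1 <;> rcases Finset.mem_insert.1 hy with hy1 | hy1
    · rw [hx1, hy1]
    · exact absurd (hx1 ▸ hxy) (hv _ hy1)
    · exact absurd (hy1 ▸ hxy.symm) (hv _ hx1)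
    · exact hT.2 _ (hSR hx1) _ (hSR hy1) hxy
  · obtain ⟨r, hr, hur⟩ := hT.1 u
    by_cases hrS : r ∈ S
    · obtain ⟨q, hq, hvq⟩ := hT.1 v
      refine ⟨q, Finset.mem_sdiff.2 ⟨hq, fun hqS => hv q hqS hvq⟩, ?_⟩
      exact Conn.through (Finset.mem_insert_of_mem hrS) (Finset.mem_insert_self _ _) hur hvq
    · exact ⟨r, Finset.mem_sdiff.2 ⟨hr, hrS⟩, hur.mono (Finset.subset_insert _ _)⟩
  · intro r hr s hs hrs
    obtain ⟨hr, hrS⟩ := Finset.mem_sdiff.1 hr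
    obtain ⟨hs, hsS⟩ := Finset.mem_sdiff.1 hs
    rcases hrs.of_insert with h | ⟨a, ha, b, hb, hra, hbs⟩
    · exact hT.2 _ hr _ hs h
    · rcases Finset.mem_insert.1 ha with rfl | ha
      · rcases Finset.mem_insert.1 hb with rfl | hb
        · exact hT.2 _ hr _ hs (hra.trans hbs)
        · exact absurd (hT.2 _ (hSR hb) _ hs hbs ▸ hb) hsS
      · exact absurd ((hT.2 _ hr _ (hSR ha) hra).symm ▸ ha) hrS

theorem trv_card [Fintype α] {r : ℕ} (E : Finset (Finset α)) :
    ∀ R : Finset α, (∀ e ∈ E, e.card = r + 1) → Acy E → Trv E R →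
      R.card + r * E.card = Fintype.card α := by
  induction E using Finset.induction_on with
  | empty =>
    intro R _ _ hT
    have : R = Finset.univ := by
      ext u
      obtain ⟨s, hs, hus⟩ := hT.1 u
      have := conn_empty hus
      subst this
      simpa using hs
    simp [this]
  | insert e E he ih =>
    intro R hk hA hT
    obtain ⟨hAE, hS⟩ := (acy_insert he).1 hA
    have hek := hk e (Finset.mem_insert_self _ _)
    obtain ⟨v, hv, hT', hd⟩ := trv_backward hS (Finset.card_pos.1 (by omega)) hT
    have := ih _ (fun f hf => hk f (Finset.mem_insert_of_mem hf)) hAE hT'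
    rw [Finset.card_union_of_disjoint hd, Finset.card_erase_of_mem hv, hek] at this
    rw [Finset.card_insert_of_notMem he]
    simp only [Nat.add_sub_cancel] at this
    linarith [this, Nat.mul_succ r E.card]

/-! ### Counting rooted hyperforests -/

section Count
open scoped Classical
variable [Fintype α]

/-- Rooted `(r+1)`-uniform hyperforests with `j` hyperedges. -/
noncomputable def RF (α : Type*) [DecidableEq α] [Fintype α] (r j : ℕ) :
    Finset (Finset (Finset α) × Finset α) :=
  Finset.univ.filter fun p =>
    (∀ e ∈ p.1, e.card = r + 1) ∧ p.1.card = j ∧ Acy p.1 ∧ Trv p.1 p.2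

theorem mem_RF {r j : ℕ} {p : Finset (Finset α) × Finset α} : p ∈ RF α r j ↔
    (∀ e ∈ p.1, e.card = r + 1) ∧ p.1.card = j ∧ Acy p.1 ∧ Trv p.1 p.2 := by
  simp [RF]

theorem card_RF_zero (r : ℕ) : (RF α r 0).card = 1 := by
  rw [Finset.card_eq_one]
  refine ⟨(∅, Finset.univ), ?_⟩
  ext ⟨E, R⟩
  rw [mem_RF, Finset.mem_singleton]
  constructor
  · rintro ⟨_, hc, _, hT⟩
    have hE : E = ∅ := Finset.card_eq_zero.1 hc
    subst hE
    refine Prod.ext rfl ?_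
    ext u
    obtain ⟨s, hs, hus⟩ := hT.1 u
    have := conn_empty hus
    subst this
    simpa using hs
  · intro h
    obtain ⟨rfl, rfl⟩ := Prod.mk.inj h
    refine ⟨by simp, by simp, by simp [Acy], fun u => ⟨u, by simp, Conn.rfl⟩, ?_⟩
    intro x _ y _ hxy
    exact conn_empty hxy

/-- Admissible root sets for attaching a hyperedge below `v`. -/
noncomputable def choices (r : ℕ) (E : Finset (Finset α)) (R : Finset α) (v : α) :
    Finset (Finset α) := (R.filter fun s => ¬ Conn E v s).powersetCard r

theorem card_choices {r j : ℕ} {p : Finset (Finset α) × Finset α} (hp : p ∈ RF α r j) (v : α) :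
    (choices r p.1 p.2 v).card = (Fintype.card α - 1 - r * j).choose r := by
  obtain ⟨hk, hc, hA, hT⟩ := mem_RF.1 hp
  have hcard := trv_card p.1 p.2 hk hA hT
  obtain ⟨q, hq, hvq⟩ := hT.1 v
  have : (p.2.filter fun s => ¬ Conn p.1 v s) = p.2.erase q := by
    ext s
    rw [Finset.mem_filter, Finset.mem_erase]
    constructor
    · rintro ⟨hs, hn⟩
      refine ⟨?_, hs⟩
      rintro rfl
      exact hn hvq
    · rintro ⟨hne, hs⟩
      exact ⟨hs, fun h => hne (hT.2 _ hs _ hq (h.symm.trans hvq))⟩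
  rw [choices, Finset.card_powersetCard, this, Finset.card_erase_of_mem hq]
  congr 1
  rw [hc] at hcard
  omega

theorem RF_rec {r : ℕ} (hr : 1 ≤ r) (j : ℕ) :
    (RF α r (j + 1)).card * (j + 1) =
      (RF α r j).card * (Fintype.card α * (Fintype.card α - 1 - r * j).choose r) := by
  have h1 : ((RF α r (j + 1)).sigma fun p => p.1).card = (RF α r (j + 1)).card * (j + 1) := by
    rw [Finset.card_sigma, Finset.sum_const_nat]
    intro p hp
    exact (mem_RF.1 hp).2.1
  have h2 : ((RF α r j).sigma fun p => (Finset.univ : Finset α).sigma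
      fun v => choices r p.1 p.2 v).card =
      (RF α r j).card * (Fintype.card α * (Fintype.card α - 1 - r * j).choose r) := by
    rw [Finset.card_sigma, Finset.sum_const_nat]
    intro p hp
    rw [Finset.card_sigma, Finset.sum_const_nat (fun v _ => card_choices hp v), Finset.card_univ]
  rw [← h1, ← h2]
  symm
  have facts : ∀ (E : Finset (Finset α)) (R : Finset α) (v : α) (S : Finset α),
      (E, R) ∈ RF α r j → S ∈ choices r E R v →
      S ⊆ R ∧ S.card = r ∧ (∀ s ∈ S, ¬ Conn E v s) ∧ v ∉ S ∧ insert v S ∉ E := by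
    intro E R v S hp hS
    rw [choices, Finset.mem_powersetCard] at hS
    obtain ⟨hS, hc⟩ := hS
    have hn : ∀ s ∈ S, ¬ Conn E v s := fun s hs => (Finset.mem_filter.1 (hS hs)).2
    refine ⟨fun s hs => (Finset.mem_filter.1 (hS hs)).1, hc, hn, fun h => hn v h Conn.rfl, ?_⟩
    intro hmem
    obtain ⟨s, hs⟩ := Finset.card_pos.1 (by omega : 0 < S.card)
    exact hn s hs (Conn.of_mem hmem (Finset.mem_insert_self _ _) (Finset.mem_insert_of_mem hs))
  refine Finset.card_bij
    (fun x _ => ⟨(insert (insert x.2.1 x.2.2) x.1.1, x.1.2 \ x.2.2), insert x.2.1 x.2.2⟩) ?_ ?_ ?_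
  · rintro ⟨⟨E, R⟩, v, S⟩ hx
    simp only [Finset.mem_sigma, Finset.mem_univ, true_and] at hx ⊢
    obtain ⟨hp, hS⟩ := hx
    obtain ⟨hSR, hSc, hn, hvS, hE⟩ := facts _ _ _ _ hp hS
    obtain ⟨hk, hc, hA, hT⟩ := mem_RF.1 hp
    simp only at hk hc hA hT
    obtain ⟨hSep, hT'⟩ := trv_forward hT hSR hn
    refine ⟨mem_RF.2 ⟨?_, ?_, (acy_insert hE).2 ⟨hA, hSep⟩, hT'⟩, Finset.mem_insert_self _ _⟩
    · intro e he
      rcases Finset.mem_insert.1 he with rfl | he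
      · rw [Finset.card_insert_of_notMem hvS, hSc]
      · exact hk e he
    · simp only
      rw [Finset.card_insert_of_notMem hE, hc]
  · rintro ⟨⟨E, R⟩, v, S⟩ hx ⟨⟨E₂, R₂⟩, v₂, S₂⟩ hx₂ heq
    simp only [Finset.mem_sigma, Finset.mem_univ, true_and] at hx hx₂
    obtain ⟨hp, hS⟩ := hx
    obtain ⟨hp₂, hS₂⟩ := hx₂
    obtain ⟨hSR, hSc, hn, hvS, hE⟩ := facts _ _ _ _ hp hS
    obtain ⟨hSR₂, hSc₂, hn₂, hvS₂, hE₂⟩ := facts _ _ _ _ hp₂ hS₂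
    obtain ⟨hk, hc, hA, hT⟩ := mem_RF.1 hp
    obtain ⟨hk₂, hc₂, hA₂, hT₂⟩ := mem_RF.1 hp₂
    simp only at hT hT₂
    simp only [Sigma.mk.injEq, Prod.mk.injEq, heq_eq_eq] at heq
    obtain ⟨⟨hEE, hRR⟩, hee⟩ := heq
    have hEeq : E = E₂ := by
      have := congrArg (fun F => F.erase (insert v S)) hEE
      rw [Finset.erase_insert hE, hee, Finset.erase_insert hE₂] at this
      exact this
    subst hEeq
    have hvv : v = v₂ := by
      by_contra hne
      have hvS2 : v ∈ S₂ := by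
        have : v ∈ insert v₂ S₂ := hee ▸ Finset.mem_insert_self _ _
        exact (Finset.mem_insert.1 this).resolve_left hne
      obtain ⟨q, hq, hvq⟩ := hT.1 v
      have hq' : q ∈ R \ S := Finset.mem_sdiff.2 ⟨hq, fun h => hn q h hvq⟩
      rw [hRR] at hq'
      obtain ⟨hq1, hq2⟩ := Finset.mem_sdiff.1 hq'
      have := hT₂.2 _ (hSR₂ hvS2) _ hq1 hvq
      subst this
      exact hq2 hvS2
    subst hvv
    have hSS : S = S₂ := by
      have := congrArg (fun F => F.erase v) hee
      rwa [Finset.erase_insert hvS, Finset.erase_insert hvS₂] at this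
    subst hSS
    have hRR' : R = R₂ := by
      rw [← Finset.sdiff_union_of_subset hSR, hRR, Finset.sdiff_union_of_subset hSR₂]
    subst hRR'
    rfl
  · rintro ⟨⟨E', R'⟩, e⟩ hx
    simp only [Finset.mem_sigma] at hx
    obtain ⟨hp, he⟩ := hx
    obtain ⟨hk, hc, hA, hT⟩ := mem_RF.1 hp
    simp only at hk hc hA hT
    obtain ⟨E, heE, rfl⟩ : ∃ E, e ∉ E ∧ insert e E = E' :=
      ⟨E'.erase e, Finset.notMem_erase _ _, Finset.insert_erase he⟩
    obtain ⟨hAE, hSep⟩ := (acy_insert heE).1 hA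
    have hek := hk e he
    obtain ⟨v, hv, hT', hd⟩ := trv_backward hSep (Finset.card_pos.1 (by omega)) hT
    rw [Finset.card_insert_of_notMem heE] at hc
    refine ⟨⟨(E, R' ∪ e.erase v), v, e.erase v⟩, ?_, ?_⟩
    · simp only [Finset.mem_sigma, Finset.mem_univ, true_and]
      refine ⟨mem_RF.2 ⟨fun f hf => hk f (Finset.mem_insert_of_mem hf), by simpa using hc, hAE,
        hT'⟩, ?_⟩
      rw [choices, Finset.mem_powersetCard]
      refine ⟨fun s hs => Finset.mem_filter.2 ⟨Finset.mem_union_right _ hs, fun h => ?_⟩, ?_⟩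
      · obtain ⟨hsv, hse⟩ := Finset.mem_erase.1 hs
        exact hsv (hSep _ hv _ hse h).symm
      · rw [Finset.card_erase_of_mem hv, hek]; rfl
    · simp only [Finset.insert_erase hv]
      rw [Finset.union_sdiff_cancel_right hd]

theorem card_RF {r n : ℕ} (hr : 1 ≤ r) (hN : Fintype.card α = r * n + 1) :
    ∀ j, j ≤ n → (RF α r j).card * j.factorial * r.factorial ^ j * (r * (n - j)).factorial =
      (r * n + 1) ^ j * (r * n).factorial := by
  intro j
  induction j with
  | zero => intro _; simp [card_RF_zero]
  | succ j ih =>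
    intro hj
    have ih := ih (by omega)
    have hrec := RF_rec (α := α) hr j
    obtain ⟨m, rfl⟩ : ∃ m, n = j + 1 + m := ⟨n - (j + 1), by omega⟩
    have e1 : j + 1 + m - (j + 1) = m := by omega
    have e2 : j + 1 + m - j = m + 1 := by omega
    have e3 : r * (j + 1 + m) + 1 - 1 - r * j = r * m + r := by
      have : r * (j + 1 + m) = r * m + r + r * j := by ring
      omega
    rw [hN, e3] at hrec
    rw [e2] at ih
    rw [e1, Nat.factorial_succ, pow_succ, pow_succ]
    have hch := Nat.add_choose_mul_factorial_mul_factorial (r * m) r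
    have e4 : r * (m + 1) = r * m + r := by ring
    rw [e4, ← hch] at ih
    calc (RF α r (j + 1)).card * ((j + 1) * j.factorial) * (r.factorial ^ j * r.factorial) *
          (r * m).factorial
        = ((RF α r (j + 1)).card * (j + 1)) * (j.factorial * r.factorial ^ j * r.factorial *
          (r * m).factorial) := by ring
      _ = (r * (j + 1 + m) + 1) * ((RF α r j).card * j.factorial * r.factorial ^ j *
          ((r * m + r).choose r * (r * m).factorial * r.factorial)) := by rw [hrec]; ring
      _ = _ := by rw [ih]; ring

theorem card_tree_mul {r n : ℕ} (hr : 1 ≤ r) (hN : Fintype.card α = r * n + 1) :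
    (Finset.univ.filter (fun E' : Finset (Finset α) =>
        IsSpanningHypertree Finset.univ
          (Finset.univ.powersetCard (r + 1)) E')).card * (r * n + 1) = (RF α r n).card := by
  rw [← hN, ← Finset.card_univ, ← Finset.card_product]
  refine Finset.card_bij (fun x _ => (x.1, {x.2})) ?_ ?_ ?_
  · rintro ⟨E, q⟩ hx
    simp only [Finset.mem_product, Finset.mem_filter, Finset.mem_univ, true_and, and_true] at hx
    obtain ⟨hE, -, hC, hA⟩ := hx
    have hk : ∀ e ∈ E, e.card = r + 1 := fun e he => (Finset.mem_powersetCard.1 (hE he)).2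
    rw [← acy_iff] at hA
    have hT : Trv E {q} := by
      refine ⟨fun u => ⟨q, by simp, hC u (by simp) q (by simp)⟩, ?_⟩
      intro x hx y hy _
      rw [Finset.mem_singleton] at hx hy
      rw [hx, hy]
    have hcard := trv_card E {q} hk hA hT
    refine mem_RF.2 ⟨hk, ?_, hA, hT⟩
    rw [hN, Finset.card_singleton] at hcard
    have : r * E.card = r * n := by omega
    exact Nat.eq_of_mul_eq_mul_left hr this
  · rintro ⟨E, q⟩ _ ⟨E₂, q₂⟩ _ h
    simp only [Prod.mk.injEq, Finset.singleton_inj] at h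
    exact Prod.ext h.1 h.2
  · rintro ⟨E, R⟩ hp
    obtain ⟨hk, hc, hA, hT⟩ := mem_RF.1 hp
    simp only at hk hc hA hT
    have hcard := trv_card E R hk hA hT
    rw [hc, hN] at hcard
    obtain ⟨q, rfl⟩ := Finset.card_eq_one.1 (by omega : R.card = 1)
    refine ⟨(E, q), ?_, rfl⟩
    simp only [Finset.mem_product, Finset.mem_filter, Finset.mem_univ, true_and, and_true]
    refine ⟨fun e he => Finset.mem_powersetCard.2 ⟨Finset.subset_univ _, hk e he⟩,
      fun e _ => Finset.subset_univ _, ?_, (acy_iff E).1 hA⟩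
    have hq : ∀ u, Conn E u q := fun u => by
      obtain ⟨s, hs, hus⟩ := hT.1 u
      rw [Finset.mem_singleton] at hs
      rwa [hs] at hus
    intro u _ v _
    exact (hq u).trans (hq v).symm

end Count

open scoped Classical in
/-- The number of spanning hypertrees of the complete `k`-uniform hypergraph on
`N = (k-1)·n + 1` vertices equals
`((k-1)n)! / (((k-1)n + 1)·n!) · (((k-1)n + 1)/(k-1)!)^n`. -/
theorem card_spanning_hypertrees_complete
    (k n : ℕ) (hk : 2 ≤ k) :
    ((Finset.univ.filter (fun E' : Finset (Finset (Fin ((k - 1) * n + 1))) =>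
        IsSpanningHypertree Finset.univ
          (Finset.univ.powersetCard k) E')).card : ℚ)
      = (Nat.factorial ((k - 1) * n) : ℚ) / (((k - 1) * n + 1) * Nat.factorial n)
        * ((((k - 1) * n + 1 : ℕ) : ℚ) / (Nat.factorial (k - 1) : ℚ)) ^ n := by
  obtain ⟨r, rfl⟩ : ∃ r, k = r + 1 := ⟨k - 1, by omega⟩
  have hr : 1 ≤ r := by omega
  have h1 := card_tree_mul (α := Fin (r * n + 1)) hr (Fintype.card_fin _)
  have h2 := card_RF (α := Fin (r * n + 1)) hr (Fintype.card_fin _) n le_rfl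
  rw [← h1] at h2
  simp only [Nat.sub_self, Nat.mul_zero, Nat.factorial_zero, Nat.mul_one] at h2
  generalize hT : (Finset.univ.filter (fun E' : Finset (Finset (Fin (r * n + 1))) =>
        IsSpanningHypertree Finset.univ
          (Finset.univ.powersetCard (r + 1)) E')).card = T at h2
  refine Eq.trans (congrArg Nat.cast (show _ = T from hT)) ?_
  simp only [Nat.add_sub_cancel]
  have h3 : (T : ℚ) * (r * n + 1) * n.factorial * (r.factorial : ℚ) ^ n =
      (r * n + 1) ^ n * (r * n).factorial := by exact_mod_cast h2
  have p1 : (n.factorial : ℚ) ≠ 0 := by positivity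
  have p2 : (r.factorial : ℚ) ≠ 0 := by positivity
  have p3 : (r * n + 1 : ℚ) ≠ 0 := by positivity
  push_cast
  rw [add_sub_cancel_right, div_pow, div_mul_div_comm, eq_div_iff (by positivity)]
  linarith
end

section
/- Let T be a spanning hypertree of the complete 3-uniform hypergraph on {1,…,N} with hyperedges A_1,…,A_n, N = 2n+1. The conjugacy-class sign ε(T), defined as the signature of any permutation σ satisfying τ_{A_1}⋯τ_{A_n} = σ τ_{[N]} σ^{-1}, is well defined: it is independent both of the choice of σ and of the ordering of the hyperedges A_1,…,A_n. -/
variable {α : Type*} [DecidableEq α]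

/-- `rotPerm S` is the permutation that cyclically rotates the elements of the finite set
`S` in their natural order, fixing everything outside `S`. -/
def rotPerm {β : Type*} [DecidableEq β] [LinearOrder β] (S : Finset β) : Equiv.Perm β :=
  (S.sort (· ≤ ·)).formPerm

theorem apply_inv_self' {β : Type*} (g : Equiv.Perm β) (x : β) : g (g⁻¹ x) = x := by simp

open Equiv Equiv.Perm in
theorem rot_spec {β : Type*} [LinearOrder β] (A : Finset β) (a b c : β)
    (hab : a ≠ b) (hac : a ≠ c) (hbc : b ≠ c) (hA : A = {a, b, c}) :
    (rotPerm A = swap a b * swap b c) ∨ (rotPerm A = swap a c * swap c b) := by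
  have hl : (A.sort (· ≤ ·)).Perm [a, b, c] := by
    rw [List.perm_ext_iff_of_nodup (Finset.sort_nodup _ _) (by simp [hab, hac, hbc])]
    intro x; simp [hA]
  have h1 : [a, b, c].formPerm = swap a b * swap b c := by simp
  have h2 : [a, c, b].formPerm = swap a c * swap c b := by simp
  have key : ∀ l : List β, l.Perm [a,b,c] → l.formPerm = swap a b * swap b c ∨
      l.formPerm = swap a c * swap c b := by
    intro l hl
    have n1 : [a,b,c].Nodup := by simp [hab, hac, hbc]
    have n2 : [a,c,b].Nodup := by simp [hab, hac, hbc.symm]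
    rw [← h1, ← h2]
    have hm : l ∈ [a,b,c].permutations := List.mem_permutations.2 hl
    have r1 : [b,c,a].formPerm = [a,b,c].formPerm := List.formPerm_rotate _ n1 1
    have r2 : [c,a,b].formPerm = [a,b,c].formPerm := List.formPerm_rotate _ n1 2
    have r3 : [c,b,a].formPerm = [a,c,b].formPerm := List.formPerm_rotate _ n2 1
    have r4 : [b,a,c].formPerm = [a,c,b].formPerm := List.formPerm_rotate _ n2 2
    simp [List.permutations, List.permutationsAux, List.permutationsAux.rec, List.permutationsAux2] at hm
    rcases hm with rfl | rfl | rfl | rfl | rfl | rfl <;> simp only [r1, r2, r3, r4, true_or, or_true]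
  exact key _ hl

open Equiv Equiv.Perm in
theorem rot_sign {β : Type*} [LinearOrder β] [Fintype β] (A : Finset β) (h : A.card = 3) :
    sign (rotPerm A) = 1 := by
  obtain ⟨a, b, c, hab, hac, hbc, hA⟩ := Finset.card_eq_three.1 h
  rcases rot_spec A a b c hab hac hbc hA with h | h <;>
    simp [h, sign_swap, hab, hac, hbc, hbc.symm]

open Equiv Equiv.Perm in
theorem prod_sign {β : Type*} [LinearOrder β] [Fintype β] (L : List (Finset β))
    (h : ∀ A ∈ L, A.card = 3) : sign (L.map rotPerm).prod = 1 := by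
  induction L with
  | nil => simp
  | cons A L ih =>
    simp only [List.map_cons, List.prod_cons, Perm.sign_mul]
    rw [rot_sign A (h A (by simp)), ih (fun B hB => h B (by simp [hB]))]; rfl

theorem rot_fix {β : Type*} [LinearOrder β] (A : Finset β) (x : β) (h : x ∉ A) :
    rotPerm A x = x := by
  apply List.formPerm_apply_of_notMem
  simpa using h

theorem prod_fix {β : Type*} [LinearOrder β] (L : List (Finset β)) (x : β)
    (h : ∀ A ∈ L, x ∉ A) : (L.map rotPerm).prod x = x := by
  induction L with
  | nil => simp
  | cons A L ih =>
    simp only [List.map_cons, List.prod_cons, Equiv.Perm.mul_apply]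
    rw [ih (fun B hB => h B (by simp [hB])), rot_fix A x (h A (by simp))]

/-- Trees built by successively attaching triples at one old vertex. -/
inductive Grown {β : Type*} [DecidableEq β] : Finset β → List (Finset β) → Prop
  | base (v : β) : Grown {v} []
  | step (V : Finset β) (L : List (Finset β)) (a b c : β) (h : Grown V L) (ha : a ∈ V)
      (hb : b ∉ V) (hc : c ∉ V) (hbc : b ≠ c) :
      Grown (insert b (insert c V)) ({a, b, c} :: L)

theorem Grown.sub {β : Type*} [DecidableEq β] {V : Finset β} {L : List (Finset β)}
    (h : Grown V L) : ∀ A ∈ L, A ⊆ V ∧ A.card = 3 := by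
  induction h with
  | base v => simp
  | step V L a b c h ha hb hc hbc ih =>
    have hab : a ≠ b := fun h => hb (h ▸ ha)
    have hac : a ≠ c := fun h => hc (h ▸ ha)
    intro A hA
    rcases List.mem_cons.1 hA with rfl | hA
    · refine ⟨?_, Finset.card_eq_three.2 ⟨a, b, c, hab, hac, hbc, rfl⟩⟩
      intro x; simp only [Finset.mem_insert, Finset.mem_singleton]
      rintro (rfl | rfl | rfl) <;> simp [ha]
    · refine ⟨?_, (ih A hA).2⟩
      intro x hx
      simp [(ih A hA).1 hx]

open Equiv Equiv.Perm in
theorem trans_step {β : Type*} [LinearOrder β] [Fintype β] (V : Finset β) (a b c : β)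
    (ha : a ∈ V) (hb : b ∉ V) (hc : c ∉ V) (hbc : b ≠ c) (C : Perm β)
    (hfix : ∀ x, x ∉ V → C x = x)
    (htr : ∀ x ∈ V, SameCycle C a x) :
    ∀ x ∈ insert b (insert c V), SameCycle (swap a b * swap b c * C) a x := by
  have hab : a ≠ b := fun h => hb (h ▸ ha)
  have hac : a ≠ c := fun h => hc (h ▸ ha)
  set P := swap a b * swap b c * C with hP
  have hCV : ∀ x, x ∈ V → C x ∈ V := by
    intro x hx
    by_contra h
    have := C.injective (hfix _ h)
    exact h (this.symm ▸ hx)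
  have hpow : ∀ k : ℕ, (C ^ k) a ∈ V := by
    intro k
    induction k with
    | zero => simpa
    | succ k ih => rw [pow_succ', mul_apply]; exact hCV _ ih
  have hk : ∀ k : ℕ, SameCycle P a ((C ^ k) a) := by
    intro k
    induction k with
    | zero => exact SameCycle.refl _ _
    | succ k ih =>
      rw [pow_succ', mul_apply]
      have hy := hCV _ (hpow k)
      set y := (C ^ k) a
      have hyb : C y ≠ b := fun h => hb (h ▸ hy)
      have hyc : C y ≠ c := fun h => hc (h ▸ hy)
      by_cases hya : C y = a
      · rw [hya]
      · have : P y = C y := by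
          rw [hP, mul_apply, mul_apply, swap_apply_of_ne_of_ne hyb hyc,
            swap_apply_of_ne_of_ne hya hyb]
        rw [← this]
        exact sameCycle_apply_right.2 ih
  have hV : ∀ x ∈ V, SameCycle P a x := by
    intro x hx
    obtain ⟨i, -, hi⟩ := (htr x hx).exists_pow_eq'
    rw [← hi]; exact hk i
  have hinv : C⁻¹ a ∈ V := by
    by_contra h
    have := hfix _ h
    rw [apply_inv_self'] at this
    exact h (this ▸ ha)
  have hB : SameCycle P a b := by
    have : P (C⁻¹ a) = b := by
      rw [hP, mul_apply, mul_apply, apply_inv_self', swap_apply_of_ne_of_ne hab hac, swap_apply_left]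
    rw [← this]
    exact sameCycle_apply_right.2 (hV _ hinv)
  have hC : SameCycle P a c := by
    have : P b = c := by
      rw [hP, mul_apply, mul_apply, hfix b hb, swap_apply_left,
        swap_apply_of_ne_of_ne hac.symm hbc.symm]
    rw [← this]
    exact sameCycle_apply_right.2 hB
  intro x hx
  simp only [Finset.mem_insert] at hx
  rcases hx with rfl | rfl | hx
  exacts [hB, hC, hV x hx]

open Equiv Equiv.Perm in
theorem split_conj {β : Type*} [LinearOrder β] (X Y : List (Finset β)) (A : Finset β) :
    ((X ++ A :: Y).map rotPerm).prod = (X.map rotPerm).prod *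
      (rotPerm A * ((Y ++ X).map rotPerm).prod) * (X.map rotPerm).prod⁻¹ := by
  simp [mul_assoc]

open Equiv Equiv.Perm in
theorem Grown.main {β : Type*} [LinearOrder β] [Fintype β] {V : Finset β} {L : List (Finset β)}
    (h : Grown V L) :
    (∀ L₁ : List (Finset β), L₁.Perm L → ∀ x ∈ V, ∀ y ∈ V, SameCycle (L₁.map rotPerm).prod x y) ∧
    (∀ L₁ L₂ : List (Finset β), L₁.Perm L → L₂.Perm L → ∃ p : Perm β, sign p = 1 ∧
      (∀ x, x ∉ V → p x = x) ∧
      p * (L₁.map rotPerm).prod * p⁻¹ = (L₂.map rotPerm).prod) := by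
  induction h with
  | base v =>
    refine ⟨?_, ?_⟩
    · intro L₁ _ x hx y hy
      rw [Finset.mem_singleton.1 hx, Finset.mem_singleton.1 hy]
    · intro L₁ L₂ h1 h2
      rw [List.perm_nil.1 h1, List.perm_nil.1 h2]
      exact ⟨1, by simp⟩
  | step V L a b c h ha hb hc hbc ih =>
    have hab : a ≠ b := fun h => hb (h ▸ ha)
    have hac : a ≠ c := fun h => hc (h ▸ ha)
    have hsub := h.sub
    have hsub' := (Grown.step V L a b c h ha hb hc hbc).sub
    obtain ⟨ih1, ih2⟩ := ih
    have hfix : ∀ L₁ : List (Finset β), L₁.Perm L → ∀ x, x ∉ V → (L₁.map rotPerm).prod x = x := by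
      intro L₁ hL x hx
      exact prod_fix _ _ (fun A hA hxA => hx ((hsub A (hL.subset hA)).1 hxA))
    have hsplit : ∀ L₁ : List (Finset β), L₁.Perm ({a, b, c} :: L) → ∃ X Y, L₁ = X ++ {a, b, c} :: Y ∧
        (Y ++ X).Perm L := by
      intro L₁ hL
      obtain ⟨X, Y, rfl⟩ := List.append_of_mem (hL.symm.subset (List.mem_cons_self))
      refine ⟨X, Y, rfl, ?_⟩
      exact List.perm_append_comm.trans ((List.perm_middle.symm.trans hL).cons_inv)
    have hX : ∀ (X Y : List (Finset β)), (Y ++ X).Perm L → sign (X.map rotPerm).prod = 1 ∧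
        ∀ x, x ∉ V → (X.map rotPerm).prod x = x := by
      intro X Y hL
      have : ∀ A ∈ X, A ∈ L := fun A hA => hL.subset (by simp [hA])
      exact ⟨prod_sign _ (fun A hA => (hsub A (this A hA)).2),
        fun x hx => prod_fix _ _ (fun A hA hxA => hx ((hsub A (this A hA)).1 hxA))⟩
    refine ⟨?_, ?_⟩
    · intro L₁ hL
      obtain ⟨X, Y, rfl, hYX⟩ := hsplit L₁ hL
      have key : ∀ x ∈ insert b (insert c V), SameCycle (rotPerm {a, b, c} * ((Y ++ X).map rotPerm).prod) a x := by
        rcases rot_spec {a, b, c} a b c hab hac hbc rfl with h | h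
        · rw [h]
          exact trans_step V a b c ha hb hc hbc _ (hfix _ hYX) (ih1 _ hYX a ha)
        · rw [h, Finset.insert_comm]
          exact trans_step V a c b ha hc hb hbc.symm _ (hfix _ hYX) (ih1 _ hYX a ha)
      rw [split_conj]
      have hXf := (hX X Y hYX).2
      set g := (X.map rotPerm).prod
      have hg : ∀ x ∈ insert b (insert c V), g⁻¹ x ∈ insert b (insert c V) := by
        intro x hx
        by_contra hn
        have hn' : g⁻¹ x ∉ V := fun h =>
          hn (Finset.mem_insert_of_mem (Finset.mem_insert_of_mem h))
        have := hXf _ hn'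
        rw [apply_inv_self'] at this
        exact hn (this ▸ hx)
      intro x hx y hy
      rw [sameCycle_conj]
      exact (key _ (hg x hx)).symm.trans (key _ (hg y hy))
    · intro L₁ L₂ h1 h2
      obtain ⟨X₁, Y₁, rfl, hYX1⟩ := hsplit L₁ h1
      obtain ⟨X₂, Y₂, rfl, hYX2⟩ := hsplit L₂ h2
      obtain ⟨p, hp, hpf, hpc⟩ := ih2 _ _ hYX1 hYX2
      rw [split_conj, split_conj]
      obtain ⟨s1, f1⟩ := hX X₁ Y₁ hYX1
      obtain ⟨s2, f2⟩ := hX X₂ Y₂ hYX2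
      have f0 := hfix _ hYX2
      have s0 : sign ((Y₂ ++ X₂).map rotPerm).prod = 1 :=
        prod_sign _ (fun A hA => (hsub A (hYX2.subset hA)).2)
      have hpa : p a ∈ V := by
        by_contra hn
        exact hn ((p.injective (hpf _ hn)).symm ▸ ha)
      obtain ⟨k, -, hk⟩ := (ih1 _ hYX2 _ hpa _ ha).exists_pow_eq'
      set g1 := (X₁.map rotPerm).prod
      set g2 := (X₂.map rotPerm).prod
      set C1 := ((Y₁ ++ X₁).map rotPerm).prod
      set C2 := ((Y₂ ++ X₂).map rotPerm).prod
      have fk : ∀ x, x ∉ V → (C2 ^ k) x = x := fun x hx => pow_apply_eq_self_of_apply_eq_self (f0 x hx) k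
      set q := C2 ^ k * p with hq
      have qa : q a = a := hk
      have qf : ∀ x, x ∉ V → q x = x := by
        intro x hx
        rw [hq, mul_apply, hpf x hx, fk x hx]
      have qs : sign q = 1 := by simp [hq, hp, s0]
      have qc : q * C1 * q⁻¹ = C2 := by
        have : q * C1 * q⁻¹ = C2 ^ k * (p * C1 * p⁻¹) * (C2 ^ k)⁻¹ := by rw [hq]; group
        rw [this, hpc]; group
      have qt : q * rotPerm {a, b, c} * q⁻¹ = rotPerm {a, b, c} := by
        have e : ∀ x y, q * swap x y * q⁻¹ = swap (q x) (q y) := fun x y => by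
          rw [swap_apply_apply]
        have e2 : ∀ s t : Perm β, q * (s * t) * q⁻¹ = (q * s * q⁻¹) * (q * t * q⁻¹) := by
          intro s t; group
        rcases rot_spec {a, b, c} a b c hab hac hbc rfl with h | h <;>
          rw [h, e2, e, e, qa, qf b hb, qf c hc]
      refine ⟨g2 * q * g1⁻¹, by simp [s1, s2, qs], ?_, ?_⟩
      · intro x hx
        have hx : x ∉ V := fun h => hx (by simp [h])
        have : g1⁻¹ x = x := by rw [inv_eq_iff_eq]; exact (f1 x hx).symm
        rw [mul_apply, mul_apply, this, qf x hx, f2 x hx]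
      · have : g2 * q * g1⁻¹ * (g1 * (rotPerm {a, b, c} * C1) * g1⁻¹) * (g2 * q * g1⁻¹)⁻¹ =
          g2 * ((q * rotPerm {a, b, c} * q⁻¹) * (q * C1 * q⁻¹)) * g2⁻¹ := by group
        rw [this, qt, qc]

theorem exists_exit {β : Type*} [DecidableEq β] [Fintype β] (E : Finset (Finset β))
    (hconn : HypConnected Finset.univ E) (V : Finset β) (hne : V.Nonempty) (hV : V ≠ Finset.univ) :
    ∃ e ∈ E, (∃ x ∈ e, x ∈ V) ∧ ¬ e ⊆ V := by
  by_contra hcon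
  push Not at hcon
  obtain ⟨u, hu⟩ := hne
  apply hV
  ext w
  simp only [Finset.mem_univ, iff_true]
  have := hconn u (Finset.mem_univ _) w (Finset.mem_univ _)
  induction this with
  | refl => exact hu
  | tail _ h ih =>
    obtain ⟨-, e, he, h1, h2⟩ := h
    exact hcon e he ⟨_, h1, ih⟩ h2

theorem union_card {β : Type*} [DecidableEq β] (V e : Finset β) (h3 : e.card = 3)
    (h : ∃ x ∈ e, x ∈ V) : (V ∪ e).card ≤ V.card + 2 := by
  obtain ⟨x, hx, hxV⟩ := h
  have h1 := Finset.card_union_add_card_inter V e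
  have : 0 < (V ∩ e).card := Finset.card_pos.2 ⟨x, by simp [hx, hxV]⟩
  omega

theorem count_bound {β : Type*} [DecidableEq β] [Fintype β] (E : Finset (Finset β))
    (hconn : HypConnected Finset.univ E) (hu : ∀ A ∈ E, A.card = 3) (m : ℕ) :
    ∀ (V : Finset β) (S : Finset (Finset β)), V.Nonempty → (∀ e ∈ S, e ⊆ V) → (E \ S).card = m →
      Fintype.card β ≤ V.card + 2 * m := by
  induction m with
  | zero =>
    intro V S hne hS hm
    by_cases hV : V = Finset.univ
    · simp [hV]
    obtain ⟨e, he, -, hn⟩ := exists_exit E hconn V hne hV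
    have : e ∈ E \ S := Finset.mem_sdiff.2 ⟨he, fun h => hn (hS e h)⟩
    simp [Finset.card_eq_zero.1 hm] at this
  | succ m ih =>
    intro V S hne hS hm
    by_cases hV : V = Finset.univ
    · rw [hV, Finset.card_univ]; omega
    obtain ⟨e, he, hx, hn⟩ := exists_exit E hconn V hne hV
    have hmem : e ∈ E \ S := Finset.mem_sdiff.2 ⟨he, fun h => hn (hS e h)⟩
    have := ih (V ∪ e) (insert e S) (hne.mono Finset.subset_union_left) (by
      intro f hf
      rcases Finset.mem_insert.1 hf with rfl | hf
      · exact Finset.subset_union_right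
      · exact (hS f hf).trans Finset.subset_union_left) (by
      rw [Finset.sdiff_insert, Finset.card_erase_of_mem hmem, hm]; rfl)
    have := union_card V e (hu e he) hx
    omega

theorem grow {β : Type*} [DecidableEq β] [Fintype β] (n : ℕ) (E : Finset (Finset β))
    (hN : Fintype.card β = 2 * n + 1) (v : β)
    (hconn : HypConnected Finset.univ E) (hu : ∀ A ∈ E, A.card = 3) (hcard : E.card = n) (k : ℕ)
    (hk : k ≤ n) :
    ∃ V L, Grown (β := β) V L ∧ L.Nodup ∧ L.length = k ∧ V.card = 2 * k + 1 ∧ L.toFinset ⊆ E := by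
  induction k with
  | zero => exact ⟨{v}, [], Grown.base v, by simp⟩
  | succ k ih =>
    obtain ⟨V, L, hG, hnd, hlen, hVc, hLE⟩ := ih (by omega)
    have hne : V.Nonempty := Finset.card_pos.1 (by omega)
    obtain ⟨e, he, hx, hn⟩ := exists_exit E hconn V hne (by
      rintro rfl; rw [Finset.card_univ] at hVc; omega)
    have hs := hG.sub
    have heL : e ∉ L := fun h => hn (hs e h).1
    have hins : (insert e L.toFinset).card = k + 1 := by
      rw [Finset.card_insert_of_notMem (by simpa using heL), List.toFinset_card_of_nodup hnd, hlen]
    have hinsE : insert e L.toFinset ⊆ E := Finset.insert_subset he hLE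
    have hb := count_bound E hconn hu (n - (k + 1)) (V ∪ e) (insert e L.toFinset)
      (hne.mono Finset.subset_union_left) (by
      intro f hf
      rcases Finset.mem_insert.1 hf with rfl | hf
      · exact Finset.subset_union_right
      · exact ((hs f (by simpa using hf)).1).trans Finset.subset_union_left) (by
      rw [Finset.card_sdiff_of_subset hinsE, hins, hcard])
    have hle := union_card V e (hu e he) hx
    have h3 := hu e he
    have h1 := Finset.card_union_add_card_inter V e
    have hi : (V ∩ e).card = 1 := by omega
    have hd : (e \ V).card = 2 := by
      have := Finset.card_sdiff_add_card_inter e V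
      rw [Finset.inter_comm] at this
      omega
    obtain ⟨a, ha⟩ := Finset.card_eq_one.1 hi
    obtain ⟨b, c, hbc, hd'⟩ := Finset.card_eq_two.1 hd
    have ha' : a ∈ V ∩ e := by simp [ha]
    have hb' : b ∈ e \ V := by simp [hd']
    have hc' : c ∈ e \ V := by simp [hd']
    rw [Finset.mem_sdiff] at hb' hc'
    rw [Finset.mem_inter] at ha'
    have hee : e = {a, b, c} := by
      have : e = (V ∩ e) ∪ (e \ V) := by
        rw [Finset.inter_comm, Finset.union_comm, Finset.sdiff_union_inter]
      rw [this, ha, hd']; rfl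
    refine ⟨insert b (insert c V), {a, b, c} :: L,
      Grown.step V L a b c hG ha'.1 hb'.2 hc'.2 hbc, ?_, by simp [hlen], ?_, ?_⟩
    · rw [← hee]; exact List.nodup_cons.2 ⟨heL, hnd⟩
    · rw [Finset.card_insert_of_notMem (by simp [hbc, hb'.2]), Finset.card_insert_of_notMem hc'.2]
      omega
    · rw [← hee, List.toFinset_cons]; exact hinsE

open Equiv Equiv.Perm in
theorem sign_of_commute {β : Type*} [DecidableEq β] [Fintype β] (v : β) (P g : Perm β)
    (htr : ∀ y, SameCycle P v y) (hs : sign P = 1) (hc : g * P = P * g) : sign g = 1 := by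
  obtain ⟨k, hk⟩ := htr (g v)
  have : g = P ^ k := by
    ext y
    obtain ⟨j, rfl⟩ := htr y
    have h1 : g * P ^ j = P ^ j * g := (Commute.zpow_right (show Commute g P from hc) j).eq
    rw [← mul_apply, h1, mul_apply, ← hk, ← mul_apply, ← mul_apply, ← zpow_add, ← zpow_add, add_comm]
  rw [this, map_zpow, hs, one_zpow]



/-- The sign `ε(T)` of a spanning hypertree of the complete 3-uniform hypergraph on
`Fin (2n+1)` is well defined: if `L₁`, `L₂` are two orderings of the hyperedges of `T`
and `σ₁`, `σ₂` are permutations conjugating the corresponding products of cyclic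
rotations to the canonical `N`-cycle, then `sgn σ₁ = sgn σ₂`. -/
theorem hypertree_sign_well_defined
    (n : ℕ) (E' : Finset (Finset (Fin (2 * n + 1))))
    (huniform : ∀ A ∈ E', A.card = 3)
    (htree : IsHypertree Finset.univ E') (hcard : E'.card = n)
    (L₁ L₂ : List (Finset (Fin (2 * n + 1))))
    (hnodup₁ : L₁.Nodup) (hL₁ : L₁.toFinset = E')
    (hnodup₂ : L₂.Nodup) (hL₂ : L₂.toFinset = E')
    (σ₁ σ₂ : Equiv.Perm (Fin (2 * n + 1)))
    (h₁ : (L₁.map rotPerm).prod = σ₁ * rotPerm Finset.univ * σ₁⁻¹)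
    (h₂ : (L₂.map rotPerm).prod = σ₂ * rotPerm Finset.univ * σ₂⁻¹) :
    Equiv.Perm.sign σ₁ = Equiv.Perm.sign σ₂ := by
  obtain ⟨V, L, hG, hnd, hlen, hVc, hLE⟩ := grow n E' (by simp) 0 htree.2.1 huniform hcard n le_rfl
  have hV : V = Finset.univ := by
    apply Finset.eq_univ_of_card; simp [hVc]
  have hLE' : L.toFinset = E' := by
    apply Finset.eq_of_subset_of_card_le hLE
    rw [List.toFinset_card_of_nodup hnd, hlen, hcard]
  have hp : ∀ L' : List (Finset (Fin (2 * n + 1))), L'.Nodup → L'.toFinset = E' → L'.Perm L := by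
    intro L' h1 h2
    exact List.perm_of_nodup_nodup_toFinset_eq h1 hnd (h2.trans hLE'.symm)
  obtain ⟨m1, m2⟩ := hG.main
  obtain ⟨p, hps, -, hpc⟩ := m2 L₁ L₂ (hp _ hnodup₁ hL₁) (hp _ hnodup₂ hL₂)
  have htr := m1 L₁ (hp _ hnodup₁ hL₁)
  have hs : Equiv.Perm.sign (L₁.map rotPerm).prod = 1 :=
    prod_sign _ (fun A hA => huniform A (by rw [← hL₁]; simpa using hA))
  have hg := sign_of_commute (0 : Fin (2 * n + 1)) (L₁.map rotPerm).prod (σ₁ * σ₂⁻¹ * p)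
    (fun y => htr 0 (by simp [hV]) y (by simp [hV])) hs (by
      have e1 : p * (L₁.map rotPerm).prod = (L₂.map rotPerm).prod * p := by rw [← hpc]; group
      rw [mul_assoc, e1, h₁, h₂]; group)
  rw [Equiv.Perm.sign_mul, hps, mul_one, Equiv.Perm.sign_mul, Equiv.Perm.sign_inv] at hg
  have h2 := Int.units_mul_self (Equiv.Perm.sign σ₂)
  exact mul_right_cancel (hg.trans h2.symm)
end
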